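/- Let V : ℝ → ℝ be continuous with |V(y)| ≤ C e^{y/(2M)} for y ≤ a (some a ∈ ℝ, M > 0) and V ∈ L¹(ℝ). For λ ∈ ℝ let f₋(x,λ) = e^{−iλx} m₋(x,λ) be the Jost solution normalized at −∞, so that m₋ satisfies m₋(x,λ) = 1 + ∫_{−∞}^x (e^{2iλ(y−x)}−1)/(2iλ)·V(y)·m₋(y,λ) dy. Then for every λ₀ > 0 and m ∈ ℕ₀ there are constants C_m such that |∂_λ^m m₋(x,λ)| ≤ C_m and |∂_λ^m m₋'(x,λ)| ≤ C_m for all x ≤ a and all λ ∈ [−λ₀, λ₀]. In particular, m₋ extends smoothly in λ through λ = 0. -/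

import Mathlib

open Set MeasureTheory Complex

open scoped BoundedContinuousFunction

/-- A family of bounded continuous functions with pointwise derivative given by a norm-continuous
family is differentiable in the sup norm. -/
lemma BoundedContinuousFunction.hasDerivAt_of_pointwise {F F' : ℝ → ℝ →ᵇ ℂ}
    (h : ∀ l s, HasDerivAt (fun r => F r s) (F' l s) l) (hc : Continuous F') (l : ℝ) :
    HasDerivAt F (F' l) l := by
  have hF : F = fun r => F 0 + ∫ t in (0 : ℝ)..r, F' t := by
    funext r
    ext s
    have h1 := (BoundedContinuousFunction.evalCLM ℝ (β := ℂ) s).intervalIntegral_comp_comm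
      (hc.intervalIntegrable (μ := volume) 0 r)
    have h2 : ∫ t in (0 : ℝ)..r, F' t s = F r s - F 0 s :=
      intervalIntegral.integral_eq_sub_of_hasDerivAt (fun t _ => h t s)
        (((BoundedContinuousFunction.evalCLM ℝ (β := ℂ) s).continuous.comp hc).intervalIntegrable
          0 r)
    have h3 : (∫ t in (0 : ℝ)..r, F' t) s = F r s - F 0 s := h1.symm.trans h2
    rw [BoundedContinuousFunction.add_apply, h3]
    ring
  have h4 := (hc.integral_hasStrictDerivAt 0 l).hasDerivAt.const_add (F 0)
  rwa [← hF] at h4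

/-- The `n`-th `l`-derivative of the damped oscillation `s ↦ exp (-2 i l s) exp (-η |s|)`. -/
noncomputable def dampedOsc (η : ℝ) (n : ℕ) (l s : ℝ) : ℂ :=
  (-2 * I * s) ^ n * cexp (-2 * I * l * s) * (Real.exp (-η * |s|) : ℂ)

lemma continuous_dampedOsc (η : ℝ) (n : ℕ) (l : ℝ) : Continuous (dampedOsc η n l) := by
  unfold dampedOsc
  fun_prop

lemma norm_exp_osc (l s : ℝ) : ‖cexp (-2 * I * l * s)‖ = 1 := by
  rw [show -2 * I * l * s = ((-2 * l * s : ℝ) : ℂ) * I by push_cast; ring]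
  exact norm_exp_ofReal_mul_I _

lemma norm_dampedOsc_le {η : ℝ} (hη : 0 < η) (n : ℕ) (l s : ℝ) :
    ‖dampedOsc η n l s‖ ≤ (2 / η) ^ n * n.factorial := by
  have h1 : (η * |s|) ^ n / n.factorial ≤ Real.exp (η * |s|) :=
    Real.pow_div_factorial_le_exp _ (by positivity) n
  have h2 : ‖dampedOsc η n l s‖ = (2 * |s|) ^ n * Real.exp (-η * |s|) := by
    unfold dampedOsc
    rw [norm_mul, norm_mul, norm_exp_osc, norm_pow, norm_mul, norm_mul, norm_neg, norm_I,
      norm_real, norm_real, Real.norm_eq_abs, Real.norm_eq_abs, Real.abs_exp]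
    simp
  rw [h2, neg_mul, Real.exp_neg, ← div_eq_mul_inv, div_le_iff₀ (Real.exp_pos _)]
  have h3 : (2 * |s|) ^ n = (2 / η) ^ n * (η * |s|) ^ n := by
    rw [← mul_pow]; congr 1; field_simp
  rw [h3, mul_assoc]
  gcongr
  rwa [div_le_iff₀' (by positivity)] at h1

lemma hasDerivAt_dampedOsc (η : ℝ) (n : ℕ) (l s : ℝ) :
    HasDerivAt (fun r => dampedOsc η n r s) (dampedOsc η (n + 1) l s) l := by
  unfold dampedOsc
  have h1 : HasDerivAt (fun r : ℝ => -2 * I * (r : ℂ) * s) (-2 * I * s) l := by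
    simpa using ((hasDerivAt_id l).ofReal_comp.const_mul (-2 * I)).mul_const (s : ℂ)
  exact ((h1.cexp.const_mul ((-2 * I * (s : ℂ)) ^ n)).mul_const
    (Real.exp (-η * |s|) : ℂ)).congr_deriv (by ring)

/-- `dampedOsc` as a bounded continuous function. -/
noncomputable def dampedOscBCF {η : ℝ} (hη : 0 < η) (n : ℕ) (l : ℝ) : ℝ →ᵇ ℂ :=
  .ofNormedAddCommGroup (dampedOsc η n l) (continuous_dampedOsc η n l) _
    (norm_dampedOsc_le hη n l)

lemma continuous_dampedOscBCF {η : ℝ} (hη : 0 < η) (n : ℕ) :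
    Continuous (dampedOscBCF hη n) := by
  have hK : 0 ≤ (2 / η) ^ (n + 1) * ((n + 1).factorial : ℝ) := by positivity
  refine (LipschitzWith.of_dist_le_mul (K := ⟨_, hK⟩) fun l r => ?_).continuous
  refine (BoundedContinuousFunction.dist_le (by positivity)).2 fun s => ?_
  rw [dist_eq_norm, dist_eq_norm]
  exact convex_univ.norm_image_sub_le_of_norm_hasDerivWithin_le
    (fun t _ => (hasDerivAt_dampedOsc η n t s).hasDerivWithinAt)
    (fun t _ => norm_dampedOsc_le hη (n + 1) t s) (mem_univ r) (mem_univ l)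

lemma hasDerivAt_dampedOscBCF {η : ℝ} (hη : 0 < η) (n : ℕ) (l : ℝ) :
    HasDerivAt (dampedOscBCF hη n) (dampedOscBCF hη (n + 1) l) l :=
  BoundedContinuousFunction.hasDerivAt_of_pointwise (fun l s => hasDerivAt_dampedOsc η n l s)
    (continuous_dampedOscBCF hη (n + 1)) l

lemma contDiff_dampedOscBCF {η : ℝ} (hη : 0 < η) (n : ℕ) :
    ContDiff ℝ (⊤ : ℕ∞) (dampedOscBCF hη n) := by
  refine contDiff_infty.2 fun k => ?_
  induction k generalizing n with
  | zero => exact contDiff_zero.2 (continuous_dampedOscBCF hη n)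
  | succ k ih =>
    have hd : deriv (dampedOscBCF hη n) = dampedOscBCF hη (n + 1) :=
      funext fun l => (hasDerivAt_dampedOscBCF hη n l).deriv
    rw [Nat.cast_succ, contDiff_succ_iff_deriv, hd]
    exact ⟨fun l => (hasDerivAt_dampedOscBCF hη n l).differentiableAt, by simp, ih (n + 1)⟩

/-- The primitive, with exponentially growing weight on the integrand and damping outside,
as a bounded operator: `(J g)(s) = exp (-2η|s|) ∫₀ˢ exp (η|t|) g(t) dt`. -/
lemma exists_dampedPrimitive {η : ℝ} (hη : 0 < η) :
    ∃ J : (ℝ →ᵇ ℂ) →L[ℝ] (ℝ →ᵇ ℂ), ∀ g s,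
      J g s = (Real.exp (-(2 * η) * |s|) : ℂ) * ∫ t in (0 : ℝ)..s, (Real.exp (η * |t|) : ℂ) * g t := by
  have hcont (g : ℝ →ᵇ ℂ) : Continuous fun t : ℝ => (Real.exp (η * |t|) : ℂ) * g t := by fun_prop
  have hbound (g : ℝ →ᵇ ℂ) (s : ℝ) : ‖(Real.exp (-(2 * η) * |s|) : ℂ) *
      ∫ t in (0 : ℝ)..s, (Real.exp (η * |t|) : ℂ) * g t‖ ≤ 1 / η * ‖g‖ := by
    have h1 : ‖∫ t in (0 : ℝ)..s, (Real.exp (η * |t|) : ℂ) * g t‖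
        ≤ Real.exp (η * |s|) * ‖g‖ * |s - 0| := by
      refine intervalIntegral.norm_integral_le_of_norm_le_const fun t ht => ?_
      rw [norm_mul, norm_real, Real.norm_eq_abs, Real.abs_exp]
      have ht' : |t| ≤ |s| := by
        rcases le_total 0 s with hs | hs
        · rw [uIoc_of_le hs] at ht
          rw [abs_of_nonneg hs, abs_of_pos ht.1]; exact ht.2
        · rw [uIoc_of_ge hs] at ht
          rw [abs_of_nonpos hs, abs_of_nonpos ht.2]; linarith [ht.1]
      gcongr
      exact g.norm_coe_le_norm t
    rw [norm_mul, norm_real, Real.norm_eq_abs, Real.abs_exp]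
    have h2 : η * |s| ≤ Real.exp (η * |s|) := by linarith [Real.add_one_le_exp (η * |s|)]
    have h3 : Real.exp (-(2 * η) * |s|) * Real.exp (η * |s|) * Real.exp (η * |s|) = 1 := by
      rw [← Real.exp_add, ← Real.exp_add, ← Real.exp_zero]; congr 1; ring
    calc _ ≤ Real.exp (-(2 * η) * |s|) * (Real.exp (η * |s|) * ‖g‖ * |s - 0|) := by gcongr
      _ = 1 / η * ‖g‖ * (Real.exp (-(2 * η) * |s|) * Real.exp (η * |s|) * (η * |s|)) := by
        rw [sub_zero]; field_simp
      _ ≤ 1 / η * ‖g‖ *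
          (Real.exp (-(2 * η) * |s|) * Real.exp (η * |s|) * Real.exp (η * |s|)) := by gcongr
      _ = _ := by rw [h3, mul_one]
  refine ⟨LinearMap.mkContinuous
    { toFun := fun g => .ofNormedAddCommGroup _ ?_ _ (hbound g)
      map_add' := fun g h => ?_
      map_smul' := fun c g => ?_ } (1 / η) fun g => ?_, fun g s => rfl⟩
  · exact (by fun_prop : Continuous fun s : ℝ => (Real.exp (-(2 * η) * |s|) : ℂ)).mul
      (intervalIntegral.continuous_primitive (fun _ _ => (hcont g).intervalIntegrable _ _) 0)
  · ext s
    simp only [BoundedContinuousFunction.coe_ofNormedAddCommGroup,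
      BoundedContinuousFunction.add_apply, mul_add]
    rw [intervalIntegral.integral_add ((hcont g).intervalIntegrable _ _)
      ((hcont h).intervalIntegrable _ _), mul_add]
  · ext s
    simp only [BoundedContinuousFunction.coe_ofNormedAddCommGroup, RingHom.id_apply,
      BoundedContinuousFunction.smul_apply, mul_smul_comm]
    rw [intervalIntegral.integral_smul, mul_smul_comm]
  · exact BoundedContinuousFunction.norm_ofNormedAddCommGroup_le _ (by positivity) (hbound g)

/-- A dominated family of kernels `Q x` defines a bounded bilinear operator
`(g, f) ↦ ∫ g(s) Q(x,s) f(p(x) - s) ds` on bounded continuous functions. -/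
lemma exists_kernelOperator {p : ℝ → ℝ} (hp : Continuous p) {Q : ℝ → ℝ → ℝ}
    (hQ : Continuous (Function.uncurry Q)) {b : ℝ → ℝ} (hb : IntegrableOn b (Ioi 0))
    (hQb : ∀ x, ∀ s > 0, |Q x s| ≤ b s) {c : ℝ} (hc : 0 ≤ c)
    (hQc : ∀ x, ∫ s in Ioi (0 : ℝ), |Q x s| ≤ c) :
    ∃ Φ : (ℝ →ᵇ ℂ) →L[ℝ] (ℝ →ᵇ ℂ) →L[ℝ] (ℝ →ᵇ ℂ), ‖Φ‖ ≤ c ∧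
      ∀ g f x, Φ g f x = ∫ s in Ioi (0 : ℝ), g s * Q x s * f (p x - s) := by
  have hQx (x : ℝ) : Continuous (Q x) := hQ.comp (by fun_prop : Continuous fun s => (x, s))
  have hQs (s : ℝ) : Continuous (fun x => Q x s) :=
    hQ.comp (by fun_prop : Continuous fun x => (x, s))
  have hcont (g f : ℝ →ᵇ ℂ) (x : ℝ) : Continuous fun s => g s * Q x s * f (p x - s) := by
    have := hQx x
    fun_prop
  have hnorm (g f : ℝ →ᵇ ℂ) (x s : ℝ) :
      ‖g s * Q x s * f (p x - s)‖ ≤ ‖g‖ * ‖f‖ * |Q x s| := by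
    rw [norm_mul, norm_mul, norm_real, Real.norm_eq_abs]
    calc _ ≤ ‖g‖ * |Q x s| * ‖f‖ := by
          gcongr
          · exact g.norm_coe_le_norm s
          · exact f.norm_coe_le_norm _
      _ = _ := by ring
  have hint (x : ℝ) : IntegrableOn (fun s => |Q x s|) (Ioi 0) := by
    refine hb.mono' (hQx x).abs.aestronglyMeasurable ?_
    filter_upwards [ae_restrict_mem measurableSet_Ioi] with s hs
    rw [Real.norm_eq_abs, abs_abs]
    exact hQb x s hs
  have hint' (g f : ℝ →ᵇ ℂ) (x : ℝ) :
      IntegrableOn (fun s => g s * Q x s * f (p x - s)) (Ioi 0) :=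
    ((hint x).const_mul (‖g‖ * ‖f‖)).mono' (hcont g f x).aestronglyMeasurable
      (.of_forall fun s => hnorm g f x s)
  have hbound (g f : ℝ →ᵇ ℂ) (x : ℝ) :
      ‖∫ s in Ioi (0 : ℝ), g s * Q x s * f (p x - s)‖ ≤ c * ‖g‖ * ‖f‖ := by
    calc _ ≤ ∫ s in Ioi (0 : ℝ), ‖g‖ * ‖f‖ * |Q x s| :=
          norm_integral_le_of_norm_le ((hint x).const_mul _) (.of_forall fun s => hnorm g f x s)
      _ = ‖g‖ * ‖f‖ * ∫ s in Ioi (0 : ℝ), |Q x s| := integral_const_mul _ _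
      _ ≤ ‖g‖ * ‖f‖ * c := by gcongr; exact hQc x
      _ = _ := by ring
  have hcontx (g f : ℝ →ᵇ ℂ) :
      Continuous fun x => ∫ s in Ioi (0 : ℝ), g s * Q x s * f (p x - s) := by
    refine continuous_of_dominated (bound := fun s => ‖g‖ * ‖f‖ * b s)
      (fun x => (hcont g f x).aestronglyMeasurable) (fun x => ?_) (hb.const_mul _)
      (.of_forall fun s => ?_)
    · filter_upwards [ae_restrict_mem measurableSet_Ioi] with s hs
      exact (hnorm g f x s).trans (by gcongr; exact hQb x s hs)
    · have := hQs s
      fun_prop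
  refine ⟨LinearMap.mkContinuous₂ (LinearMap.mk₂ ℝ
    (fun g f => (.ofNormedAddCommGroup _ (hcontx g f) _ (hbound g f) : ℝ →ᵇ ℂ))
    ?_ ?_ ?_ ?_) c fun g f => ?_, LinearMap.mkContinuous₂_norm_le _ hc _, fun g f x => rfl⟩
  · intro g h f
    ext x
    simp only [BoundedContinuousFunction.coe_ofNormedAddCommGroup,
      BoundedContinuousFunction.add_apply, add_mul]
    exact integral_add (hint' g f x) (hint' h f x)
  · intro r g f
    ext x
    simp only [BoundedContinuousFunction.coe_ofNormedAddCommGroup,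
      BoundedContinuousFunction.smul_apply, smul_mul_assoc]
    exact integral_smul _ _
  · intro g f h
    ext x
    simp only [BoundedContinuousFunction.coe_ofNormedAddCommGroup,
      BoundedContinuousFunction.add_apply, mul_add]
    exact integral_add (hint' g f x) (hint' g h x)
  · intro r g f
    ext x
    simp only [BoundedContinuousFunction.coe_ofNormedAddCommGroup,
      BoundedContinuousFunction.smul_apply, mul_smul_comm]
    exact integral_smul _ _
  · exact BoundedContinuousFunction.norm_ofNormedAddCommGroup_le _ (by positivity) (hbound g f)

/-- Solutions of `u = v + T u` depend smoothly on the parameter as long as `‖T‖ < 1`. -/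
lemma contDiff_of_eq_add_apply {E : Type*} [NormedAddCommGroup E] [NormedSpace ℝ E]
    [CompleteSpace E] {T : ℝ → E →L[ℝ] E} {n : WithTop ℕ∞} (hT : ContDiff ℝ n T)
    (hT1 : ∀ l, ‖T l‖ < 1) {u : ℝ → E} {v : E} (hu : ∀ l, u l = v + T l (u l)) :
    ContDiff ℝ n u := by
  have hunit (l : ℝ) : IsUnit (1 - T l) := isUnit_one_sub_of_norm_lt_one (hT1 l)
  have heq : u = fun l => Ring.inverse (1 - T l) v := by
    funext l
    have h1 : (1 - T l) (u l) = v := by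
      rw [sub_apply, one_apply_eq_self, sub_eq_iff_eq_add]
      exact hu l
    rw [← h1, ← mul_apply_eq_comp, Ring.inverse_mul_cancel _ (hunit l),
      one_apply_eq_self]
  have hinv : ContDiff ℝ n fun l => Ring.inverse (1 - T l) := by
    refine contDiff_iff_contDiffAt.2 fun l => ?_
    obtain ⟨w, hw⟩ := hunit l
    have h2 : ContDiffAt ℝ n Ring.inverse (1 - T l) := hw ▸ contDiffAt_ringInverse ℝ w
    exact h2.comp l (contDiff_const.sub hT).contDiffAt
  rw [heq]
  exact hinv.clm_apply contDiff_const

lemma ContinuousLinearMap.iteratedDeriv_comp {E F : Type*} [NormedAddCommGroup E]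
    [NormedSpace ℝ E] [NormedAddCommGroup F] [NormedSpace ℝ F] (L : E →L[ℝ] F) {f : ℝ → E}
    (hf : ContDiff ℝ (⊤ : ℕ∞) f) (n : ℕ) (l : ℝ) :
    iteratedDeriv n (fun r => L (f r)) l = L (iteratedDeriv n f l) := by
  have h := L.iteratedFDeriv_comp_left (x := l) (i := n) hf.contDiffAt (by exact_mod_cast le_top)
  simp only [iteratedDeriv]
  exact congrArg (fun A => A fun _ => (1 : ℝ)) h

/-- Multiples of the values of a smooth curve of bounded continuous functions have smooth
dependence on the parameter, with locally uniformly bounded derivatives. -/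
lemma contDiff_and_bound_of_eq_mul_apply {P : ℝ → ℝ →ᵇ ℂ} (hP : ContDiff ℝ (⊤ : ℕ∞) P)
    {f : ℝ → ℝ → ℂ} {w : ℝ → ℝ} {S : Set ℝ} {R : ℝ} (hw : ∀ x ∈ S, |w x| ≤ R)
    (hf : ∀ x ∈ S, ∀ l, f x l = w x * P l x) :
    (∀ x ∈ S, ContDiff ℝ (⊤ : ℕ∞) (f x)) ∧
      ∀ (b : ℝ) (n : ℕ), ∃ C, ∀ x ∈ S, ∀ l ∈ Icc (-b) b, ‖iteratedDeriv n (f x) l‖ ≤ C := by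
  let L (x : ℝ) : (ℝ →ᵇ ℂ) →L[ℝ] ℂ := w x • BoundedContinuousFunction.evalCLM ℝ x
  have hL (x : ℝ) (g : ℝ →ᵇ ℂ) : L x g = w x * g x := Complex.real_smul
  have hfL (x) (hx : x ∈ S) : f x = fun l => L x (P l) :=
    funext fun l => (hf x hx l).trans (hL x _).symm
  refine ⟨fun x hx => ?_, fun b n => ?_⟩
  · rw [hfL x hx]
    exact (L x).contDiff.comp hP
  · obtain ⟨C, hC⟩ := isCompact_Icc.exists_bound_of_continuousOn (s := Icc (-b) b)
      (hP.continuous_iteratedDeriv n (by exact_mod_cast le_top)).continuousOn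
    refine ⟨R * C, fun x hx l hl => ?_⟩
    rw [hfL x hx, (L x).iteratedDeriv_comp hP, hL, norm_mul, norm_real, Real.norm_eq_abs]
    have hR : 0 ≤ R := (abs_nonneg _).trans (hw x hx)
    gcongr
    · exact hw x hx
    · exact (BoundedContinuousFunction.norm_coe_le_norm _ x).trans (hC l hl)

lemma setIntegral_Iic_eq_Ioi_sub (F : ℝ → ℂ) (x : ℝ) :
    ∫ y in Iic x, F y = ∫ s in Ioi (0 : ℝ), F (x - s) := by
  rw [← integral_indicator measurableSet_Iic, ← integral_sub_left_eq_self _ volume x,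
    ← integral_Ici_eq_integral_Ioi, ← integral_indicator measurableSet_Ici]
  congr 1
  funext s
  simp [indicator]

lemma integrableOn_Iic_of_continuous {F : ℝ → ℂ} (hF : Continuous F) {a : ℝ}
    (hFi : IntegrableOn F (Iic a)) (t : ℝ) : IntegrableOn F (Iic t) :=
  (hFi.union (hF.integrableOn_Icc (a := a) (b := t))).mono_set fun y (hy : y ≤ t) =>
    (le_total y a).imp id fun h => ⟨h, hy⟩

lemma hasDerivAt_integral_Iic {F : ℝ → ℂ} (hF : Continuous F) {a : ℝ}
    (hFi : IntegrableOn F (Iic a)) (x : ℝ) :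
    HasDerivAt (fun t => ∫ y in Iic t, F y) (F x) x := by
  have hi := integrableOn_Iic_of_continuous hF hFi
  have h1 : (fun t => ∫ y in Iic t, F y) = fun t => (∫ y in Iic a, F y) + ∫ y in a..t, F y := by
    funext t
    rw [← intervalIntegral.integral_Iic_sub_Iic (hi a) (hi t)]
    ring
  rw [h1]
  exact (hF.integral_hasStrictDerivAt a x).hasDerivAt.const_add _

lemma integrableOn_and_integral_exp_mul_exp {ε β : ℝ} (hε : 0 < ε) (hβ : 0 < β) (x : ℝ) :
    IntegrableOn (fun s => Real.exp (ε * (x - s)) * Real.exp (β * Real.exp (ε * (x - s))))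
      (Ioi 0) ∧
    ∫ s in Ioi (0 : ℝ), Real.exp (ε * (x - s)) * Real.exp (β * Real.exp (ε * (x - s))) =
      (Real.exp (β * Real.exp (ε * x)) - 1) / (ε * β) := by
  have hd (s : ℝ) : HasDerivAt (fun s => -Real.exp (β * Real.exp (ε * (x - s))) / (ε * β))
      (Real.exp (ε * (x - s)) * Real.exp (β * Real.exp (ε * (x - s)))) s := by
    have h1 : HasDerivAt (fun s : ℝ => ε * (x - s)) (-ε) s := by
      simpa using ((hasDerivAt_id s).const_sub x).const_mul ε
    refine (((h1.exp.const_mul β).exp.neg).div_const (ε * β)).congr_deriv ?_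
    field_simp
  have hlim : Filter.Tendsto (fun s => -Real.exp (β * Real.exp (ε * (x - s))) / (ε * β))
      Filter.atTop (nhds (-Real.exp (β * 0) / (ε * β))) := by
    refine ((Real.continuous_exp.tendsto _).comp (Filter.Tendsto.const_mul β ?_)).neg.div_const _
    refine Real.tendsto_exp_atBot.comp (Filter.Tendsto.const_mul_atBot hε ?_)
    exact Filter.tendsto_atBot_add_const_left _ x Filter.tendsto_neg_atTop_atBot
  refine ⟨integrableOn_Ioi_deriv_of_nonneg' (fun s _ => hd s) (fun s _ => by positivity) hlim, ?_⟩
  rw [integral_Ioi_of_hasDerivAt_of_nonneg' (fun s _ => hd s) (fun s _ => by positivity) hlim]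
  simp only [mul_zero, Real.exp_zero, sub_zero]
  ring

/-- The `x`-derivative of a solution of the Volterra equation. -/
lemma hasDerivAt_of_volterra {V : ℝ → ℝ} (hV : Continuous V) {μ : ℝ → ℂ} (hμ : Continuous μ)
    {a l : ℝ} (hi : IntegrableOn (fun y => V y * μ y) (Iic a))
    (hi1 : IntegrableOn (fun y : ℝ => (y : ℂ) * (V y * μ y)) (Iic a))
    (h : l ≠ 0 → ∀ x : ℝ, μ x = 1 + ∫ y in Iic x,
      ((cexp (2 * I * l * (y - x)) - 1) / (2 * I * l)) * (V y : ℂ) * μ y)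
    (h0 : l = 0 → ∀ x : ℝ, μ x = 1 + ∫ y in Iic x, ((y : ℂ) - (x : ℂ)) * (V y : ℂ) * μ y)
    (x : ℝ) :
    HasDerivAt μ (-∫ y : ℝ in Iic x, cexp (2 * I * l * (y - x)) * (V y * μ y)) x := by
  have hc : Continuous fun y => (V y : ℂ) * μ y := by fun_prop
  have hB := hasDerivAt_integral_Iic hc hi x
  by_cases hl : l = 0
  · have hc1 : Continuous fun y : ℝ => (y : ℂ) * (V y * μ y) := by fun_prop
    have hA := hasDerivAt_integral_Iic hc1 hi1 x
    have hx : HasDerivAt (fun t : ℝ => (t : ℂ)) 1 x := (hasDerivAt_id x).ofReal_comp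
    have heq : μ = fun t : ℝ => 1 + ((∫ y in Iic t, (y : ℂ) * (V y * μ y)) -
        t * ∫ y in Iic t, V y * μ y) := by
      funext t
      rw [← integral_const_mul, ← integral_sub (integrableOn_Iic_of_continuous hc1 hi1 t) ((integrableOn_Iic_of_continuous hc hi t).const_mul _)]
      refine (h0 hl t).trans ?_
      congr 2
      funext y
      ring
    have hd := (hA.sub (hx.mul hB)).const_add 1
    rw [heq]
    refine hd.congr_deriv ?_
    rw [← heq]
    simp [hl]
  · have hc1 : Continuous fun y : ℝ => cexp (2 * I * l * y) * (V y * μ y) := by fun_prop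
    have hi2 : IntegrableOn (fun y : ℝ => cexp (2 * I * l * y) * (V y * μ y)) (Iic a) := by
      refine hi.norm.mono' hc1.aestronglyMeasurable (.of_forall fun y => ?_)
      have := norm_exp_osc (-l) y
      rw [show -2 * I * ((-l : ℝ) : ℂ) * y = 2 * I * l * y by push_cast; ring] at this
      rw [norm_mul, this, one_mul]
    have hA := hasDerivAt_integral_Iic hc1 hi2 x
    have hlin : HasDerivAt (fun t : ℝ => -2 * I * l * (t : ℂ)) (-2 * I * l) x := by
      simpa using (hasDerivAt_id x).ofReal_comp.const_mul (-2 * I * (l : ℂ))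
    have hl' : (l : ℂ) ≠ 0 := by exact_mod_cast hl
    have hsplit (t y : ℝ) : cexp (2 * I * l * (y - t)) =
        cexp (-2 * I * l * t) * cexp (2 * I * l * y) := by
      rw [← Complex.exp_add]; congr 1; ring
    have heq : μ = fun t : ℝ => 1 + (cexp (-2 * I * l * t) *
        (∫ y in Iic t, cexp (2 * I * l * y) * (V y * μ y)) - ∫ y in Iic t, V y * μ y) /
          (2 * I * l) := by
      funext t
      rw [← integral_const_mul, ← integral_sub ((integrableOn_Iic_of_continuous hc1 hi2 t).const_mul _) (integrableOn_Iic_of_continuous hc hi t),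
        ← integral_div]
      refine (h hl t).trans ?_
      congr 2
      funext y
      rw [hsplit]
      ring
    have hd := (((hlin.cexp.mul hA).sub hB).div_const (2 * I * l)).const_add 1
    have hint : ∫ y : ℝ in Iic x, cexp (2 * I * l * (y - x)) * (V y * μ y) =
        cexp (-2 * I * l * x) * ∫ y in Iic x, cexp (2 * I * l * y) * (V y * μ y) := by
      rw [← integral_const_mul]
      congr 1
      funext y
      rw [hsplit]
      ring
    have hone : cexp (-2 * I * l * x) * cexp (2 * I * l * x) = 1 := by
      rw [← Complex.exp_add, ← Complex.exp_zero]; congr 1; ring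
    rw [hint]
    refine (hd.congr_of_eventuallyEq (.of_eq heq)).congr_deriv ?_
    rw [div_eq_iff (by simp [hl', I_ne_zero])]
    linear_combination (V x * μ x) * hone

/-- For an exponentially decaying potential, conjugating the Volterra operators with the weight
`exp (β exp (ε x))` makes the norm of the kernel operator as small as desired. -/
lemma exists_weightedOperator {V : ℝ → ℝ} (hV : Continuous V) {a C ε : ℝ} (hC : 0 < C)
    (hε : 0 < ε) (hVdec : ∀ y ≤ a, |V y| ≤ C * Real.exp (2 * ε * y)) {c : ℝ} (hc : 0 < c) :
    ∃ β > 0, ∃ Φ : (ℝ →ᵇ ℂ) →L[ℝ] (ℝ →ᵇ ℂ) →L[ℝ] (ℝ →ᵇ ℂ), ‖Φ‖ ≤ c ∧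
      ∀ g f x, Φ g f x = ∫ s in Ioi (0 : ℝ), g s *
        ((Real.exp (ε * s) * V (min x a - s) * Real.exp (β * Real.exp (ε * (min x a - s))) /
          Real.exp (β * Real.exp (ε * min x a)) : ℝ) : ℂ) * f (min x a - s) := by
  obtain ⟨β, hβ, hβc⟩ : ∃ β > 0, C * Real.exp (ε * a) / (ε * β) = c :=
    ⟨C * Real.exp (ε * a) / (ε * c), by positivity, by field_simp⟩
  have hp : Continuous fun x : ℝ => min x a := by fun_prop
  have hQ (x s : ℝ) (hs : 0 < s) :
      |Real.exp (ε * s) * V (min x a - s) * Real.exp (β * Real.exp (ε * (min x a - s))) /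
        Real.exp (β * Real.exp (ε * min x a))| ≤
      C * Real.exp (ε * a) / Real.exp (β * Real.exp (ε * min x a)) *
        (Real.exp (ε * (min x a - s)) * Real.exp (β * Real.exp (ε * (min x a - s)))) := by
    have hx : min x a ≤ a := min_le_right _ _
    rw [abs_div, abs_mul, abs_mul, Real.abs_exp, Real.abs_exp, Real.abs_exp, div_mul_eq_mul_div]
    gcongr ?_ / _
    rw [← mul_assoc]
    gcongr ?_ * _
    calc _ ≤ Real.exp (ε * s) * (C * Real.exp (2 * ε * (min x a - s))) := by
          gcongr; exact hVdec _ (by linarith)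
      _ = C * Real.exp (ε * min x a) * Real.exp (ε * (min x a - s)) := by
          rw [mul_left_comm, ← Real.exp_add, mul_assoc C, ← Real.exp_add]; congr 2; ring
      _ ≤ _ := by gcongr
  refine ⟨β, hβ, exists_kernelOperator hp (b := fun s => C * Real.exp (ε * a) *
    (Real.exp (ε * a) * Real.exp (-ε * s))) ?_ ?_ ?_ hc.le ?_⟩
  · unfold Function.uncurry
    exact Continuous.div (by fun_prop) (by fun_prop) fun _ => (Real.exp_pos _).ne'
  · exact ((exp_neg_integrableOn_Ioi 0 hε).const_mul _).const_mul _
  · intro x s hs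
    refine (hQ x s hs).trans ?_
    rw [div_mul_eq_mul_div, div_le_iff₀ (Real.exp_pos _), ← mul_assoc, ← Real.exp_add]
    gcongr ?_ * Real.exp ?_ * Real.exp ?_
    · linarith [mul_le_mul_of_nonneg_left (min_le_right x a) hε.le]
    · gcongr; linarith
  · intro x
    obtain ⟨hi, hI⟩ := integrableOn_and_integral_exp_mul_exp hε hβ (min x a)
    have hmono := integral_mono_of_nonneg (μ := volume.restrict (Ioi (0 : ℝ)))
      (.of_forall fun s => abs_nonneg _) (hi.const_mul _)
      ((ae_restrict_mem measurableSet_Ioi).mono fun s hs => hQ x s hs)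
    refine hmono.trans ?_
    rw [integral_const_mul, hI, ← hβc, div_mul_div_comm, div_le_div_iff₀ (by positivity)
      (by positivity)]
    have := Real.exp_pos (β * Real.exp (ε * min x a))
    have h1 : 0 < C * Real.exp (ε * a) * (ε * β) := by positivity
    nlinarith

lemma integral_osc_mul {l s : ℝ} (hl : l ≠ 0) :
    ∫ t in (0 : ℝ)..s, cexp (-2 * I * l * t) =
      -((cexp (2 * I * l * ((s : ℝ) * (-1))) - 1) / (2 * I * l)) := by
  have hl' : (l : ℂ) ≠ 0 := by exact_mod_cast hl
  rw [integral_exp_mul_complex (by simp [hl', I_ne_zero])]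
  simp only [ofReal_zero, mul_zero, Complex.exp_zero]
  rw [show -2 * I * (l : ℂ) * s = 2 * I * l * (s * (-1)) by ring,
    show -2 * I * (l : ℂ) = -(2 * I * l) by ring, div_neg]

/-- Uniform smallness in `λ` of the Jost function `mMinus(x,λ)` normalized at `−∞`, for a
potential decaying exponentially on `(−∞,a]`: all `λ`-derivatives of `mMinus` and of
`mMinus' = ∂ₓmMinus` are bounded uniformly for `x ≤ a`, `λ ∈ [−λ₀,λ₀]`; in particular
`mMinus` is smooth in `λ` through `λ = 0`. -/
theorem jost_minus_small_energy_bounds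
    (V : ℝ → ℝ) (hVc : Continuous V) (hVL1 : MeasureTheory.Integrable V)
    (a C M : ℝ) (hC : 0 < C) (hM : 0 < M)
    (hVdec : ∀ y ≤ a, |V y| ≤ C * Real.exp (y / (2 * M)))
    (mMinus : ℝ → ℝ → ℂ)
    (hcont : ∀ lam : ℝ, Continuous fun x => mMinus x lam)
    (hbd : ∀ lam : ℝ, ∃ B : ℝ, ∀ x ≤ a, ‖mMinus x lam‖ ≤ B)
    (hVolt : ∀ lam : ℝ, lam ≠ 0 → ∀ x : ℝ,
      mMinus x lam = 1 + ∫ y in Set.Iic x,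
        ((Complex.exp (2 * Complex.I * lam * (y - x)) - 1) / (2 * Complex.I * lam)) *
          (V y : ℂ) * mMinus y lam)
    (hVolt0 : ∀ x : ℝ,
      mMinus x 0 = 1 + ∫ y in Set.Iic x, ((y : ℂ) - (x : ℂ)) * (V y : ℂ) * mMinus y 0) :
    (∀ x ≤ a, ContDiff ℝ (⊤ : ℕ∞) fun lam : ℝ => mMinus x lam) ∧
    ∀ lam₀ > (0 : ℝ), ∀ m : ℕ, ∃ Cm : ℝ,
      ∀ x ≤ a, ∀ lam ∈ Set.Icc (-lam₀) lam₀,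
        ‖iteratedDeriv m (fun l : ℝ => mMinus x l) lam‖ ≤ Cm ∧
        ‖iteratedDeriv m (fun l : ℝ => deriv (fun t : ℝ => mMinus t l) x) lam‖ ≤ Cm := by
  obtain ⟨ε, hε, hεM⟩ : ∃ ε > 0, ∀ y, y / (2 * M) = 2 * ε * y :=
    ⟨1 / (4 * M), by positivity, fun y => by field_simp; ring⟩
  simp only [hεM] at hVdec
  obtain ⟨J, hJ⟩ := exists_dampedPrimitive (half_pos hε)
  obtain ⟨β, hβ, Φ, hΦ, hΦeq⟩ := exists_weightedOperator hVc hC hε hVdec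
    (c := 1 / (2 * (‖J‖ + 1))) (by positivity)
  let W (x : ℝ) : ℝ := Real.exp (β * Real.exp (ε * x))
  have hW0 (x : ℝ) : 0 < W x := Real.exp_pos _
  have hWC (x : ℝ) : (W x : ℂ) ≠ 0 := by exact_mod_cast (hW0 x).ne'
  have hW1 (x : ℝ) : 1 ≤ W x := Real.one_le_exp (by positivity)
  have hWa (x : ℝ) (hx : x ∈ Iic a) : |W x| ≤ W a := by
    have hx' : x ≤ a := hx
    rw [abs_of_pos (hW0 x)]
    simp only [W]
    gcongr
  have hWcont : Continuous W := by fun_prop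
  have hquot (f : ℝ → ℂ) (hf : Continuous f) (hfb : ∃ B, ∀ x ≤ a, ‖f x‖ ≤ B) :
      ∃ u : ℝ →ᵇ ℂ, ∀ x, u x = f (min x a) / W (min x a) := by
    obtain ⟨B, hB⟩ := hfb
    refine ⟨.ofNormedAddCommGroup (fun x => f (min x a) / W (min x a))
      (Continuous.div (by fun_prop) (by fun_prop) fun x => hWC _) B fun x => ?_, fun x => rfl⟩
    rw [norm_div, norm_real, Real.norm_eq_abs, abs_of_pos (hW0 _)]
    exact (div_le_self (norm_nonneg _) (hW1 _)).trans (hB _ (min_le_right _ _))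
  choose u hu using fun l => hquot (fun x => mMinus x l) (hcont l) (hbd l)
  obtain ⟨v, hv⟩ := hquot (fun _ => 1) continuous_const ⟨1, fun x _ => by simp⟩
  have hu' (x) (hx : x ∈ Iic a) (l : ℝ) : mMinus x l = W x * u l x := by
    have hx' : x ≤ a := hx
    rw [hu, min_eq_left hx', mul_div_cancel₀ _ (hWC x)]
  have hΦu (g : ℝ →ᵇ ℂ) (l x : ℝ) : Φ g (u l) x = (∫ s in Ioi (0 : ℝ),
      (Real.exp (ε * s) : ℂ) * g s * (V (min x a - s) * mMinus (min x a - s) l)) /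
        W (min x a) := by
    rw [hΦeq, ← integral_div]
    refine setIntegral_congr_fun measurableSet_Ioi fun s hs => ?_
    have hs' : 0 < s := hs
    have hle : min x a - s ≤ a := by linarith [min_le_right x a]
    have hWe : W (min x a - s) = Real.exp (β * Real.exp (ε * (min x a - s))) := rfl
    have hWe' : W (min x a) = Real.exp (β * Real.exp (ε * min x a)) := rfl
    simp only [← hWe, ← hWe']
    rw [hu' _ hle l]
    push_cast
    ring
  have hdamp (s : ℝ) (hs : 0 < s) : (Real.exp (ε * s) : ℂ) * (Real.exp (-ε * |s|) : ℂ) = 1 := by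
    rw [← ofReal_mul, ← Real.exp_add, abs_of_pos hs]
    simp
  have hJs (l s : ℝ) (hs : 0 < s) :
      (Real.exp (ε * s) : ℂ) * J (dampedOscBCF (half_pos hε) 0 l) s =
        ∫ t in (0 : ℝ)..s, cexp (-2 * I * l * t) := by
    have hint : ∀ t : ℝ, (Real.exp (ε / 2 * |t|) : ℂ) * dampedOscBCF (half_pos hε) 0 l t =
        cexp (-2 * I * l * t) := fun t => by
      change _ * ((-2 * I * (t : ℂ)) ^ 0 * _ * (Real.exp (-(ε / 2) * |t|) : ℂ)) = _
      rw [pow_zero, one_mul, mul_left_comm, ← ofReal_mul, ← Real.exp_add]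
      simp
    rw [hJ, ← mul_assoc, show -(2 * (ε / 2)) = -ε by ring, hdamp s hs, one_mul]
    simp only [hint]
  have hΦsmooth : ContDiff ℝ (⊤ : ℕ∞) fun g => Φ g :=
    ContinuousLinearMap.contDiff (F := (ℝ →ᵇ ℂ) →L[ℝ] (ℝ →ᵇ ℂ)) Φ
  let T (l : ℝ) : (ℝ →ᵇ ℂ) →L[ℝ] (ℝ →ᵇ ℂ) := -Φ (J (dampedOscBCF (half_pos hε) 0 l))
  have hT : ContDiff ℝ (⊤ : ℕ∞) T :=
    (hΦsmooth.comp (J.contDiff.comp (contDiff_dampedOscBCF (half_pos hε) 0))).neg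
  have hT1 (l : ℝ) : ‖T l‖ < 1 := by
    have h1 : ‖dampedOscBCF (half_pos hε) 0 l‖ ≤ 1 :=
      BoundedContinuousFunction.norm_ofNormedAddCommGroup_le _ zero_le_one fun s => by
        simpa using norm_dampedOsc_le (half_pos hε) 0 l s
    calc ‖T l‖ = ‖Φ (J (dampedOscBCF (half_pos hε) 0 l))‖ := norm_neg _
      _ ≤ 1 / (2 * (‖J‖ + 1)) * (‖J‖ * 1) :=
        (Φ.le_of_opNorm_le hΦ _).trans (by gcongr; exact J.le_opNorm_of_le h1)
      _ < 1 := by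
        rw [div_mul_eq_mul_div, div_lt_one (by positivity)]
        linarith [norm_nonneg J]
  have hfix (l : ℝ) : u l = v + T l (u l) := by
    ext x
    have hvolt : mMinus (min x a) l = 1 - ∫ s in Ioi (0 : ℝ),
        (∫ t in (0 : ℝ)..s, cexp (-2 * I * l * t)) *
          (V (min x a - s) * mMinus (min x a - s) l) := by
      rw [sub_eq_add_neg, ← integral_neg]
      by_cases hl : l = 0
      · subst hl
        rw [hVolt0, setIntegral_Iic_eq_Ioi_sub]
        congr 2
        funext s
        simp
        ring
      · rw [hVolt l hl, setIntegral_Iic_eq_Ioi_sub]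
        congr 2
        funext s
        rw [integral_osc_mul hl]
        push_cast
        ring_nf
    have hTu : T l (u l) x = -(Φ (J (dampedOscBCF (half_pos hε) 0 l)) (u l) x) := rfl
    rw [BoundedContinuousFunction.add_apply, hTu, hΦu, hu, hv, ← sub_eq_add_neg, ← sub_div, hvolt]
    congr 2
    refine setIntegral_congr_fun measurableSet_Ioi fun s hs => ?_
    simp only [hJs l s hs]
  have husmooth : ContDiff ℝ (⊤ : ℕ∞) u := contDiff_of_eq_add_apply hT hT1 hfix
  have hderiv (x) (hx : x ∈ Iic a) (l : ℝ) : deriv (fun t => mMinus t l) x =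
      W x * (-Φ (dampedOscBCF hε 0 l) (u l)) x := by
    obtain ⟨B, hB⟩ := hbd l
    have hcl := hcont l
    have hb (y : ℝ) (hy : y ≤ a) : ‖(V y : ℂ) * mMinus y l‖ ≤ C * Real.exp (2 * ε * y) * B := by
      rw [norm_mul, norm_real, Real.norm_eq_abs]
      have := hVdec y hy
      gcongr
      exact hB y hy
    have hi : IntegrableOn (fun y => (V y : ℂ) * mMinus y l) (Iic a) := by
      refine (((integrableOn_exp_mul_Iic (by positivity : 0 < 2 * ε) a).const_mul C).mul_const
        B).mono' (Continuous.aestronglyMeasurable (by fun_prop)) ?_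
      filter_upwards [ae_restrict_mem measurableSet_Iic] with y hy using hb y hy
    have hi1 : IntegrableOn (fun y : ℝ => (y : ℂ) * (V y * mMinus y l)) (Iic a) := by
      have hB0 : 0 ≤ B := (norm_nonneg _).trans (hB a le_rfl)
      refine ((integrableOn_exp_mul_Iic hε a).const_mul
        (1 / ε * Real.exp (2 * ε * |a|) * C * B)).mono'
        (Continuous.aestronglyMeasurable (by fun_prop)) ?_
      filter_upwards [ae_restrict_mem measurableSet_Iic] with y hy
      have hy' : y ≤ a := hy
      have hay : |y| ≤ 2 * |a| - y := by
        rcases abs_cases y with h | h <;> linarith [le_abs_self a, abs_nonneg a]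
      have hye : |y| ≤ 1 / ε * Real.exp (2 * ε * |a| - ε * y) := by
        rw [div_mul_eq_mul_div, one_mul, le_div_iff₀ hε]
        nlinarith [Real.add_one_le_exp (2 * ε * |a| - ε * y)]
      rw [norm_mul, norm_real, Real.norm_eq_abs]
      calc _ ≤ 1 / ε * Real.exp (2 * ε * |a| - ε * y) * (C * Real.exp (2 * ε * y) * B) := by
            gcongr; exact hb y hy'
        _ = 1 / ε * C * B * (Real.exp (2 * ε * |a| - ε * y) * Real.exp (2 * ε * y)) := by ring
        _ = 1 / ε * C * B * (Real.exp (2 * ε * |a|) * Real.exp (ε * y)) := by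
            rw [← Real.exp_add, ← Real.exp_add]; congr 2; ring
        _ = _ := by ring
    rw [(hasDerivAt_of_volterra hVc hcl hi hi1 (hVolt l) (fun h => h ▸ hVolt0) x).deriv,
      BoundedContinuousFunction.neg_apply, hΦu, min_eq_left (show x ≤ a from hx), mul_neg,
      mul_div_cancel₀ _ (hWC x), setIntegral_Iic_eq_Ioi_sub]
    congr 1
    refine setIntegral_congr_fun measurableSet_Ioi fun s hs => ?_
    change _ = (Real.exp (ε * s) : ℂ) * ((-2 * I * (s : ℂ)) ^ 0 * cexp (-2 * I * l * s) *
      (Real.exp (-ε * |s|) : ℂ)) * _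
    rw [pow_zero, one_mul, mul_left_comm (Real.exp (ε * s) : ℂ), hdamp s hs, mul_one]
    congr 2
    push_cast
    ring
  have hdsmooth : ContDiff ℝ (⊤ : ℕ∞) fun l => -Φ (dampedOscBCF hε 0 l) (u l) :=
    ((hΦsmooth.comp (contDiff_dampedOscBCF hε 0)).clm_apply husmooth).neg
  obtain ⟨hsm, hbound⟩ := contDiff_and_bound_of_eq_mul_apply husmooth hWa hu'
  obtain ⟨-, hbound'⟩ := contDiff_and_bound_of_eq_mul_apply hdsmooth
    (f := fun x l => deriv (fun t => mMinus t l) x) hWa hderiv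
  refine ⟨hsm, fun b _ n => ?_⟩
  obtain ⟨C₁, hC₁⟩ := hbound b n
  obtain ⟨C₂, hC₂⟩ := hbound' b n
  exact ⟨max C₁ C₂, fun x hx l hl =>
    ⟨(hC₁ x hx l hl).trans (le_max_left _ _), (hC₂ x hx l hl).trans (le_max_right _ _)⟩⟩
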